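/- In the stochastic SQP setting with pre-specified stepsizes described in the context, assume ν ∈ (0, σ/(2(κ_v(τ_min·L + Γ) + 4))], fix K ∈ ℕ with K ≥ 1 and η > 0 with η/√K ≤ κ_β, and let β_k := η/√K for all 0 ≤ k ≤ K−1. Set κ₂ := τ_min·(f(x₀) − f_low) + ‖c(x₀)‖₁ + η²·κ₁. Then for every δ ∈ (0,1), with probability at least 1 − δ: min_{0 ≤ k ≤ K−1} [ τ_min·ζ·κ_H⁻²·‖∇f(x_k) + J_kᵀ y_k^true‖² + (σ·√K/(2η))·‖c(x_k)‖₁ ] ≤ κ₂/(ν·η·δ·√K) + 2·(1 + 2κ_u)·ζ·τ_min·κ_v·κ₂/(ν·σ·δ·K). -/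

import Mathlib

open Matrix MeasureTheory RealInnerProductSpace

/-- The ℓ¹-norm of a vector in `ℝ^m`. -/
noncomputable def l1Norm {k : ℕ} (v : EuclideanSpace ℝ (Fin k)) : ℝ := ∑ i, |v i|

/-- The Jacobian matrix of `c` at `z`, whose rows are the gradients of the components. -/
noncomputable def Jmat {m n : ℕ}
    (gradc : Fin m → EuclideanSpace ℝ (Fin n) → EuclideanSpace ℝ (Fin n))
    (z : EuclideanSpace ℝ (Fin n)) : Matrix (Fin m) (Fin n) ℝ :=
  Matrix.of fun i j => gradc i z j


theorem l1Norm_nonneg {k : ℕ} (v : EuclideanSpace ℝ (Fin k)) : 0 ≤ l1Norm v :=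
  Finset.sum_nonneg fun _ _ => abs_nonneg _

theorem norm_le_l1Norm {k : ℕ} (v : EuclideanSpace ℝ (Fin k)) : ‖v‖ ≤ l1Norm v := by
  rw [EuclideanSpace.norm_eq]
  refine Real.sqrt_le_iff.2 ⟨l1Norm_nonneg v, ?_⟩
  simpa [l1Norm] using
    Finset.sum_sq_le_sq_sum_of_nonneg (s := Finset.univ) (f := fun i => |v i|) fun i _ => abs_nonneg _

theorem continuous_l1Norm {k : ℕ} : Continuous (l1Norm (k := k)) := by
  unfold l1Norm; fun_prop

theorem inner_toEuclideanLin_right {m n : ℕ} (A : Matrix (Fin m) (Fin n) ℝ)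
    (z : EuclideanSpace ℝ (Fin m)) (w : EuclideanSpace ℝ (Fin n)) :
    ⟪z, Matrix.toEuclideanLin A w⟫ = ⟪Matrix.toEuclideanLin Aᵀ z, w⟫ := by
  rw [← Matrix.conjTranspose_eq_transpose_of_trivial,
    Matrix.toEuclideanLin_conjTranspose_eq_adjoint, LinearMap.adjoint_inner_left]

theorem toEuclideanLin_Jmat_apply {m n : ℕ}
    (gradc : Fin m → EuclideanSpace ℝ (Fin n) → EuclideanSpace ℝ (Fin n))
    (z w : EuclideanSpace ℝ (Fin n)) (i : Fin m) :
    Matrix.toEuclideanLin (Jmat gradc z) w i = ⟪gradc i z, w⟫ := by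
  simp [Matrix.toLpLin_apply, Jmat, Matrix.mulVec, dotProduct, PiLp.inner_apply, mul_comm]

/-- The descent lemma: a function with Lipschitz gradient lies below its quadratic model. -/
theorem le_quadratic_of_lipschitz_gradient {E : Type*} [NormedAddCommGroup E]
    [InnerProductSpace ℝ E] [CompleteSpace E] {f : E → ℝ} {gradf : E → E} {L : ℝ}
    (hf : ∀ z, HasGradientAt f (gradf z) z)
    (hL : ∀ z z', ‖gradf z - gradf z'‖ ≤ L * ‖z - z'‖) (z d : E) :
    f (z + d) ≤ f z + ⟪gradf z, d⟫ + L / 2 * ‖d‖ ^ 2 := by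
  have hline : ∀ t : ℝ, HasDerivAt (fun t : ℝ => f (z + t • d)) ⟪gradf (z + t • d), d⟫ t := by
    intro t
    have h1 : HasDerivAt (fun t : ℝ => z + t • d) d t := by
      simpa using ((hasDerivAt_id t).smul_const d).const_add z
    refine ((hf (z + t • d)).hasFDerivAt.comp_hasDerivAt t h1).congr_deriv ?_
    simp
  have hquad : ∀ t : ℝ, HasDerivAt
      (fun t : ℝ => f z + t * ⟪gradf z, d⟫ + L / 2 * ‖d‖ ^ 2 * t ^ 2)
      (⟪gradf z, d⟫ + L * ‖d‖ ^ 2 * t) t := by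
    intro t
    have h := (((hasDerivAt_id t).mul_const ⟪gradf z, d⟫).const_add (f z)).add
      (((hasDerivAt_id t).pow 2).const_mul (L / 2 * ‖d‖ ^ 2))
    refine h.congr_deriv ?_
    simp; ring
  have := image_le_of_deriv_right_le_deriv_boundary (a := 0) (b := 1)
    (fun t _ => (hline t).continuousAt.continuousWithinAt)
    (fun t _ => (hline t).hasDerivWithinAt) (by simp)
    (fun t _ => (hquad t).continuousAt.continuousWithinAt)
    (fun t _ => (hquad t).hasDerivWithinAt)
    (fun t ht => by
      have h1 : ⟪gradf (z + t • d) - gradf z, d⟫ ≤ L * ‖t • d‖ * ‖d‖ := by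
        refine (real_inner_le_norm _ _).trans ?_
        gcongr
        simpa using hL (z + t • d) z
      rw [inner_sub_left, norm_smul, Real.norm_of_nonneg ht.1] at h1
      linarith) (Set.right_mem_Icc.2 zero_le_one)
  simpa using this

theorem abs_sub_linear_le_of_lipschitz_gradient {E : Type*} [NormedAddCommGroup E]
    [InnerProductSpace ℝ E] [CompleteSpace E] {f : E → ℝ} {gradf : E → E} {L : ℝ}
    (hf : ∀ z, HasGradientAt f (gradf z) z)
    (hL : ∀ z z', ‖gradf z - gradf z'‖ ≤ L * ‖z - z'‖) (z d : E) :
    |f (z + d) - (f z + ⟪gradf z, d⟫)| ≤ L / 2 * ‖d‖ ^ 2 := by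
  have h1 := le_quadratic_of_lipschitz_gradient hf hL z d
  have h2 := le_quadratic_of_lipschitz_gradient (f := fun z => -f z) (gradf := fun z => -gradf z)
    (fun z => by
      have := (hf z).hasFDerivAt.neg
      rw [hasGradientAt_iff_hasFDerivAt, map_neg]
      exact this)
    (fun z z' => by simpa [norm_sub_rev, neg_add_eq_sub] using hL z z') z d
  rw [inner_neg_left] at h2
  exact abs_le.2 ⟨by linarith, by linarith⟩

theorem l1Norm_add_le {m n : ℕ} {c : EuclideanSpace ℝ (Fin n) → EuclideanSpace ℝ (Fin m)}
    {gradc : Fin m → EuclideanSpace ℝ (Fin n) → EuclideanSpace ℝ (Fin n)} {γ : Fin m → ℝ}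
    (hc : ∀ i z, HasGradientAt (fun w => c w i) (gradc i z) z)
    (hcLip : ∀ i z z', ‖gradc i z - gradc i z'‖ ≤ γ i * ‖z - z'‖)
    (z d : EuclideanSpace ℝ (Fin n)) :
    l1Norm (c (z + d)) ≤ l1Norm (c z + Matrix.toEuclideanLin (Jmat gradc z) d)
      + (∑ i, γ i) / 2 * ‖d‖ ^ 2 := by
  rw [Finset.sum_div, Finset.sum_mul, l1Norm, l1Norm, ← Finset.sum_add_distrib]
  refine Finset.sum_le_sum fun i _ => ?_
  have h := abs_sub_linear_le_of_lipschitz_gradient (hc i) (hcLip i) z d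
  rw [PiLp.add_apply, toEuclideanLin_Jmat_apply]
  linarith [abs_sub_abs_le_abs_sub (c (z + d) i) (c z i + ⟪gradc i z, d⟫)]

theorem norm_le_of_kkt {m n : ℕ} {H : Matrix (Fin n) (Fin n) ℝ} {J : Matrix (Fin m) (Fin n) ℝ}
    {ζ : ℝ} (hζ : 0 < ζ) {z r : EuclideanSpace ℝ (Fin n)} {q : EuclideanSpace ℝ (Fin m)}
    (hH : ζ * ‖z‖ ^ 2 ≤ ⟪z, Matrix.toEuclideanLin H z⟫) (hJ : Matrix.toEuclideanLin J z = 0)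
    (h : Matrix.toEuclideanLin H z + Matrix.toEuclideanLin Jᵀ q = r) :
    ‖z‖ ≤ ζ⁻¹ * ‖r‖ := by
  have h1 : ⟪z, Matrix.toEuclideanLin H z⟫ = ⟪z, r⟫ := by
    rw [← h, inner_add_right, inner_toEuclideanLin_right Jᵀ, Matrix.transpose_transpose, hJ]
    simp
  have h2 := real_inner_le_norm z r
  rcases (norm_nonneg z).eq_or_lt with h0 | h0
  · rw [← h0]; positivity
  · rw [← div_eq_inv_mul, le_div_iff₀ hζ]
    nlinarith

theorem merit_model_decrease {α β ν θ κβ τ A C κc κv κH κu κg σ ζ nut nu nv nW gu gut gv gW : ℝ}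
    (hν : 0 < ν) (hθ : 0 < θ) (hβ : 0 < β) (hβb : β ≤ κβ) (hα : α ∈ Set.Icc ν (ν + θ * β))
    (hτ : 0 < τ) (hA : 0 ≤ A) (hC : 0 ≤ C) (hCb : C ≤ κc) (hκv : 0 < κv) (hκH : 0 < κH)
    (hκu : 0 < κu) (hκg : 0 < κg) (hζ : 0 < ζ) (hσ : 0 < σ)
    (hτκ : τ * (κv * (κβ * κH * κu + κg)) = 1 - σ)
    (hνσ : ν * (κv * A + 4) ≤ σ / 2)
    (hnut : 0 ≤ nut) (hnutb : nut ≤ κu) (hnv : 0 ≤ nv) (hnvb : nv ≤ κv * C)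
    (hnvb' : nv ^ 2 ≤ κv * C) (hu : gu = gut + gW)
    (hgut : gut ≤ -ζ * nut ^ 2 + κH * nut * nv) (hgv : gv ≤ κg * nv) (hgW : |gW| ≤ κg * nW) :
    τ * (α * (β * gu + gv)) + |1 - α| * C + A / 2 * (α ^ 2 * (β ^ 2 * nu ^ 2 + nv ^ 2)) ≤
      C - (ν * β * τ * ζ * nut ^ 2 + ν * σ / 2 * C) + ν * β * τ * gW
      + θ * β ^ 2 * τ * κg * nW + θ ^ 2 * β ^ 2 * κc * (κv * A + 4)
      + (ν + θ * κβ) ^ 2 * β ^ 2 * A / 2 * nu ^ 2 := by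
  obtain ⟨hα1, hα2⟩ := hα
  have hα0 : 0 < α := hν.trans_le hα1
  have hκβ : 0 < κβ := hβ.trans_le hβb
  have habs : |1 - α| ≤ 1 - α + α ^ 2 := by
    rw [abs_le]; constructor <;> nlinarith [sq_nonneg (α - 1), sq_nonneg α]
  have hαsq : α ^ 2 ≤ 2 * ν ^ 2 + 2 * θ ^ 2 * β ^ 2 := by
    have : α ^ 2 ≤ (ν + θ * β) ^ 2 := by gcongr
    nlinarith [sq_nonneg (ν - θ * β)]
  -- the tangential term along the true step
  have e1 : α * β * gut ≤ -(ν * β * ζ * nut ^ 2) + α * (κβ * κH * κu) * (κv * C) := by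
    have a1 : α * β * gut ≤ α * β * (-ζ * nut ^ 2 + κH * nut * nv) := by gcongr
    have a2 : α * β * (κH * nut * nv) ≤ α * κβ * (κH * κu * (κv * C)) := by gcongr
    have a3 : ν * (β * ζ * nut ^ 2) ≤ α * (β * ζ * nut ^ 2) := by gcongr
    linarith
  have e2 : α * gv ≤ α * κg * (κv * C) := by
    have : α * gv ≤ α * (κg * (κv * C)) := by
      gcongr
      exact hgv.trans (by gcongr)
    linarith
  have hnW : 0 ≤ κg * nW := (abs_nonneg _).trans hgW
  -- the noise term
  have e3 : α * β * gW ≤ ν * β * gW + θ * β ^ 2 * (κg * nW) := by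
    have a1 : (α - ν) * β * gW ≤ (θ * β) * β * (κg * nW) := by
      calc (α - ν) * β * gW ≤ (α - ν) * β * (κg * nW) := by
            have : 0 ≤ (α - ν) * β := mul_nonneg (by linarith) hβ.le
            exact mul_le_mul_of_nonneg_left ((le_abs_self _).trans hgW) this
        _ ≤ _ := by gcongr; linarith
    linarith
  have e4 : τ * (α * (β * gu + gv)) ≤ -(ν * β * τ * ζ * nut ^ 2) + α * (1 - σ) * C
      + ν * β * τ * gW + θ * β ^ 2 * τ * κg * nW := by
    have := mul_le_mul_of_nonneg_left (add_le_add (add_le_add e1 e2) e3) hτ.le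
    rw [← hτκ, hu]
    linarith
  have e5 : |1 - α| * C ≤ (1 - α) * C + α ^ 2 * C := by
    have := mul_le_mul_of_nonneg_right habs hC
    linarith
  have e6 : A / 2 * (α ^ 2 * nv ^ 2) ≤ A / 2 * (α ^ 2 * (κv * C)) := by gcongr
  have e7 : A / 2 * (α ^ 2 * (β ^ 2 * nu ^ 2)) ≤ A / 2 * ((ν + θ * κβ) ^ 2 * (β ^ 2 * nu ^ 2)) := by
    gcongr
    exact hα2.trans (by gcongr)
  have e8 : α ^ 2 * (C * (κv * A + 2) / 2)
      ≤ (2 * ν ^ 2 + 2 * θ ^ 2 * β ^ 2) * (C * (κv * A + 2) / 2) := by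
    gcongr
  have e9 : θ ^ 2 * β ^ 2 * (C * (κv * A + 4)) ≤ θ ^ 2 * β ^ 2 * (κc * (κv * A + 4)) := by gcongr
  have e10 : ν * (κv * A + 4) * (ν * C) ≤ σ / 2 * (ν * C) := by gcongr
  have e11 : ν * (σ * C) ≤ α * (σ * C) := by gcongr
  have e12 : 0 ≤ ν ^ 2 * C := by positivity
  have e13 : 0 ≤ θ ^ 2 * β ^ 2 * C := by positivity
  linarith

theorem stronglyMeasurable_toEuclideanLin {m n : ℕ} {Ω : Type*} {𝒢 : MeasurableSpace Ω}
    {A : Ω → Matrix (Fin m) (Fin n) ℝ} {z : Ω → EuclideanSpace ℝ (Fin n)}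
    (hA : ∀ i j, StronglyMeasurable fun ω => A ω i j) (hz : StronglyMeasurable z) :
    StronglyMeasurable fun ω => Matrix.toEuclideanLin (A ω) (z ω) := by
  refine (PiLp.continuous_toLp 2 _).comp_stronglyMeasurable
    (measurable_pi_lambda _ fun i => ?_).stronglyMeasurable
  change Measurable fun ω => ∑ j, A ω i j * z ω j
  refine Finset.measurable_fun_sum _ fun j _ => (hA i j).measurable.mul ?_
  exact ((EuclideanSpace.proj (𝕜 := ℝ) j).continuous.comp_stronglyMeasurable hz).measurable

theorem condExp_inner_left {E Ω : Type*} [NormedAddCommGroup E] [InnerProductSpace ℝ E]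
    [CompleteSpace E] {𝒢 m0 : MeasurableSpace Ω} {μ : Measure Ω} {z X : Ω → E}
    (hz : StronglyMeasurable[𝒢] z) (hzX : Integrable (fun ω => ⟪z ω, X ω⟫) μ)
    (hX : Integrable X μ) :
    μ[fun ω => ⟪z ω, X ω⟫ | 𝒢] =ᵐ[μ] fun ω => ⟪z ω, (μ[X | 𝒢]) ω⟫ :=
  condExp_bilin_of_stronglyMeasurable_left (innerSL ℝ) hz hzX hX

theorem integrable_inner_of_memLp_two {E Ω : Type*} [NormedAddCommGroup E] [InnerProductSpace ℝ E]
    {m0 : MeasurableSpace Ω} {μ : Measure Ω} {X Y : Ω → E} (hX : MemLp X 2 μ) (hY : MemLp Y 2 μ) :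
    Integrable (fun ω => ⟪X ω, Y ω⟫) μ :=
  (hX.norm.integrable_mul hY.norm).mono' (hX.1.inner hY.1)
    (ae_of_all _ fun _ => norm_inner_le_norm _ _)

/-- If the right-hand side of a linear saddle-point system with measurable coefficients has zero
conditional mean, then so does the primal part of its solution. -/
theorem condExp_eq_zero_of_kkt {m n : ℕ} {Ω : Type*} {𝒢 m0 : MeasurableSpace Ω} {μ : Measure Ω}
    [IsProbabilityMeasure μ] (h𝒢 : 𝒢 ≤ m0)
    {H : Ω → Matrix (Fin n) (Fin n) ℝ} {J : Ω → Matrix (Fin m) (Fin n) ℝ} {ζ κH : ℝ} (hζ : 0 < ζ)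
    (hH : ∀ i j, StronglyMeasurable[𝒢] fun ω => H ω i j)
    (hJ : ∀ i j, StronglyMeasurable[𝒢] fun ω => J ω i j)
    (hHnorm : ∀ ω (z : EuclideanSpace ℝ (Fin n)), ‖Matrix.toEuclideanLin (H ω) z‖ ≤ κH * ‖z‖)
    (hHpd : ∀ ω (z : EuclideanSpace ℝ (Fin n)), Matrix.toEuclideanLin (J ω) z = 0 →
      ζ * ‖z‖ ^ 2 ≤ ⟪z, Matrix.toEuclideanLin (H ω) z⟫)
    {W e : Ω → EuclideanSpace ℝ (Fin n)} {q : Ω → EuclideanSpace ℝ (Fin m)}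
    (hW : MemLp W 2 μ) (he : MemLp e 2 μ) (he0 : μ[e | 𝒢] =ᵐ[μ] 0)
    (hJW : ∀ ω, Matrix.toEuclideanLin (J ω) (W ω) = 0)
    (hsys : ∀ ω, Matrix.toEuclideanLin (H ω) (W ω) + Matrix.toEuclideanLin (J ω)ᵀ (q ω) = -e ω) :
    μ[W | 𝒢] =ᵐ[μ] 0 := by
  set U := μ[W | 𝒢] with hU
  have hUm : StronglyMeasurable[𝒢] U := stronglyMeasurable_condExp
  have hU2 : MemLp U 2 μ := hW.condExp one_le_two
  have hWint : Integrable W μ := hW.integrable one_le_two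
  have hJU : ∀ᵐ ω ∂μ, Matrix.toEuclideanLin (J ω) (U ω) = 0 := by
    have hrow : ∀ i : Fin m, ∀ᵐ ω ∂μ, Matrix.toEuclideanLin (J ω) (U ω) i = 0 := by
      intro i
      have hz : ∀ ω, ⟪Matrix.toEuclideanLin (J ω)ᵀ (EuclideanSpace.single i 1), W ω⟫ = 0 := by
        intro ω
        rw [← inner_toEuclideanLin_right, hJW, inner_zero_right]
      have h := condExp_inner_left (μ := μ) (X := W)
        (stronglyMeasurable_toEuclideanLin (A := fun ω => (J ω)ᵀ)
          (z := fun _ => EuclideanSpace.single i (1 : ℝ)) (fun a b => hJ b a)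
          stronglyMeasurable_const) (by simp [hz]) hWint
      simp only [hz] at h
      have h0 : μ[fun _ : Ω => (0 : ℝ) | 𝒢] = fun _ => 0 := condExp_const h𝒢 0
      rw [h0] at h
      filter_upwards [h] with ω hω
      rw [← inner_toEuclideanLin_right] at hω
      simpa [EuclideanSpace.inner_single_left] using hω.symm
    filter_upwards [ae_all_iff.2 hrow] with ω hω
    ext i
    exact hω i
  have hHU : StronglyMeasurable[𝒢] fun ω => Matrix.toEuclideanLin (H ω)ᵀ (U ω) :=
    stronglyMeasurable_toEuclideanLin (fun i j => hH j i) hUm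
  have hint : Integrable (fun ω => ⟪Matrix.toEuclideanLin (H ω)ᵀ (U ω), W ω⟫) μ := by
    refine ((hU2.norm.integrable_mul hW.norm).const_mul κH).mono'
      ((hHU.mono h𝒢).aestronglyMeasurable.inner hW.1) (ae_of_all _ fun ω => ?_)
    rw [← inner_toEuclideanLin_right]
    refine (norm_inner_le_norm _ _).trans ?_
    have := mul_le_mul_of_nonneg_left (hHnorm ω (W ω)) (norm_nonneg (U ω))
    simp only [Pi.mul_apply]
    linarith
  have h1 := condExp_inner_left (μ := μ) hHU hint hWint
  have h2 := condExp_inner_left (μ := μ) hUm.neg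
    (integrable_inner_of_memLp_two hU2.neg he) (he.integrable one_le_two)
  have h3 : (fun ω => ⟪Matrix.toEuclideanLin (H ω)ᵀ (U ω), W ω⟫)
      =ᵐ[μ] fun ω => ⟪(-U) ω, e ω⟫ := by
    filter_upwards [hJU] with ω hω
    rw [← inner_toEuclideanLin_right, eq_sub_of_add_eq (hsys ω), inner_sub_right,
      inner_toEuclideanLin_right (J ω)ᵀ, Matrix.transpose_transpose, hω]
    simp
  filter_upwards [h1, h2, condExp_congr_ae (m := 𝒢) h3, he0, hJU] with ω g1 g2 g3 g4 g5
  rw [g1, g2, g4, ← inner_toEuclideanLin_right, Pi.zero_apply, inner_zero_right] at g3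
  have := (hHpd ω (U ω) g5).trans_eq g3
  have h0 : ‖U ω‖ ^ 2 ≤ 0 := by nlinarith [sq_nonneg ‖U ω‖]
  simpa using le_antisymm h0 (sq_nonneg _)

theorem integral_inner_eq_zero_of_condExp_eq_zero {E Ω : Type*} [NormedAddCommGroup E]
    [InnerProductSpace ℝ E] [CompleteSpace E] {𝒢 m0 : MeasurableSpace Ω} {μ : Measure Ω}
    [IsProbabilityMeasure μ] (h𝒢 : 𝒢 ≤ m0) {z W : Ω → E} (hz : StronglyMeasurable[𝒢] z)
    (hz2 : MemLp z 2 μ) (hW : MemLp W 2 μ) (hW0 : μ[W | 𝒢] =ᵐ[μ] 0) :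
    ∫ ω, ⟪z ω, W ω⟫ ∂μ = 0 := by
  rw [← integral_condExp h𝒢]
  refine integral_eq_zero_of_ae ?_
  filter_upwards [condExp_inner_left (μ := μ) hz (integrable_inner_of_memLp_two hz2 hW)
    (hW.integrable one_le_two), hW0] with ω h1 h2
  rw [h1, h2]
  simp

theorem integral_norm_le_sqrt {E Ω : Type*} [NormedAddCommGroup E]
    {m0 : MeasurableSpace Ω} {μ : Measure Ω} [IsProbabilityMeasure μ] {e : Ω → E} {M : ℝ}
    (hM : 0 < M) (he : MemLp e 2 μ) (h : ∫ ω, ‖e ω‖ ^ 2 ∂μ ≤ M) :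
    ∫ ω, ‖e ω‖ ∂μ ≤ √M := by
  have hs : 0 < √M := Real.sqrt_pos.2 hM
  have h2 : Integrable (fun ω => ‖e ω‖ ^ 2) μ := he.integrable_norm_pow two_ne_zero
  calc ∫ ω, ‖e ω‖ ∂μ ≤ ∫ ω, (‖e ω‖ ^ 2 * (2 * √M)⁻¹ + √M / 2) ∂μ := by
        refine integral_mono (he.integrable one_le_two).norm
          ((h2.mul_const _).add (integrable_const _)) fun ω => ?_
        have : ‖e ω‖ ^ 2 * (2 * √M)⁻¹ + √M / 2 - ‖e ω‖ = (‖e ω‖ - √M) ^ 2 / (2 * √M) := by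
          field_simp; ring
        have h0 : 0 ≤ (‖e ω‖ - √M) ^ 2 / (2 * √M) := by positivity
        dsimp only; linarith
    _ = (∫ ω, ‖e ω‖ ^ 2 ∂μ) * (2 * √M)⁻¹ + √M / 2 := by
        rw [integral_add (h2.mul_const _) (integrable_const _), integral_mul_const]; simp
    _ ≤ M * (2 * √M)⁻¹ + √M / 2 := by gcongr
    _ = √M := by
        have := Real.mul_self_sqrt hM.le
        field_simp; nlinarith

/-- Taking expectations in a one-step merit decrease whose noise terms are controlled by a
conditionally centred perturbation `W` of a bounded step `z`. -/
theorem integral_merit_step {E Ω : Type*} [NormedAddCommGroup E]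
    [InnerProductSpace ℝ E] [CompleteSpace E] {𝒢 m0 : MeasurableSpace Ω} {μ : Measure Ω}
    [IsProbabilityMeasure μ] (h𝒢 : 𝒢 ≤ m0) {a z W : Ω → E} {φ φ' G : Ω → ℝ}
    {ca cz lo b₁ b₂ b₃ b₄ D₁ D₂ : ℝ} (hb₂ : 0 ≤ b₂) (hb₄ : 0 ≤ b₄)
    (ha : StronglyMeasurable[𝒢] a) (hab : ∀ ω, ‖a ω‖ ≤ ca)
    (hz : StronglyMeasurable[𝒢] z) (hzb : ∀ ω, ‖z ω‖ ≤ cz)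
    (hW : MemLp W 2 μ) (hW0 : μ[W | 𝒢] =ᵐ[μ] 0)
    (hD₁ : ∫ ω, ‖W ω‖ ∂μ ≤ D₁) (hD₂ : ∫ ω, ‖W ω‖ ^ 2 ∂μ ≤ D₂)
    (hφ : Integrable φ μ) (hG : Integrable G μ) (hφ' : AEStronglyMeasurable φ' μ)
    (hlo : ∀ ω, lo ≤ φ' ω)
    (h : ∀ ω, φ' ω ≤ φ ω - G ω + b₁ * ⟪a ω, W ω⟫ + b₂ * ‖W ω‖ + b₃ + b₄ * ‖z ω + W ω‖ ^ 2) :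
    Integrable φ' μ ∧ ∫ ω, φ' ω ∂μ ≤
      ∫ ω, φ ω ∂μ - ∫ ω, G ω ∂μ + (b₂ * D₁ + b₃ + b₄ * ((∫ ω, ‖z ω‖ ^ 2 ∂μ) + D₂)) := by
  have ha2 : MemLp a 2 μ := .of_bound (ha.mono h𝒢).aestronglyMeasurable ca (ae_of_all _ hab)
  have hz2 : MemLp z 2 μ := .of_bound (hz.mono h𝒢).aestronglyMeasurable cz (ae_of_all _ hzb)
  have iaW := integrable_inner_of_memLp_two ha2 hW
  have izW := integrable_inner_of_memLp_two hz2 hW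
  have iW := (hW.integrable one_le_two).norm
  have iW2 : Integrable (fun ω => ‖W ω‖ ^ 2) μ := hW.integrable_norm_pow two_ne_zero
  have iz2 : Integrable (fun ω => ‖z ω‖ ^ 2) μ := hz2.integrable_norm_pow two_ne_zero
  have i1 := hφ.sub hG
  have i2 := i1.add (iaW.const_mul b₁)
  have i3 := i2.add (iW.const_mul b₂)
  have i4 := i3.add (integrable_const (μ := μ) b₃)
  have i5 := iz2.add (izW.const_mul 2)
  have i6 := i5.add iW2
  have i7 := i4.add (i6.const_mul b₄)
  simp only [norm_add_sq_real] at h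
  have hint : Integrable φ' μ := integrable_of_le_of_le hφ' (ae_of_all _ hlo) (ae_of_all _ h)
    (integrable_const lo) i7
  refine ⟨hint, (integral_mono hint i7 h).trans ?_⟩
  rw [integral_add' i4 (i6.const_mul b₄), integral_add' i3 (integrable_const _),
    integral_add' i2 (iW.const_mul b₂), integral_add' i1 (iaW.const_mul b₁), integral_sub' hφ hG,
    integral_const_mul, integral_const_mul, integral_const_mul, integral_add' i5 iW2,
    integral_add' iz2 (izW.const_mul 2), integral_const_mul,
    integral_inner_eq_zero_of_condExp_eq_zero h𝒢 ha ha2 hW hW0,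
    integral_inner_eq_zero_of_condExp_eq_zero h𝒢 hz hz2 hW hW0]
  have e1 := mul_le_mul_of_nonneg_left hD₁ hb₂
  have e2 := mul_le_mul_of_nonneg_left hD₂ hb₄
  simp only [integral_const, probReal_univ, one_smul]
  linarith

theorem continuous_of_norm_sub_le {E F : Type*} [NormedAddCommGroup E] [NormedAddCommGroup F]
    {f : E → F} {L : ℝ} (h : ∀ z z', ‖f z - f z'‖ ≤ L * ‖z - z'‖) : Continuous f :=
  (LipschitzWith.of_dist_le' (K := L) fun z z' => by simpa [dist_eq_norm] using h z z').continuous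

theorem norm_le_of_mem_range_transpose {m n : ℕ} {J : Matrix (Fin m) (Fin n) ℝ} {s : ℝ}
    (hs : 0 < s) {v : EuclideanSpace ℝ (Fin n)} {b q : EuclideanSpace ℝ (Fin m)}
    (hq : s * ‖q‖ ≤ ‖Matrix.toEuclideanLin Jᵀ q‖) (hv : v = Matrix.toEuclideanLin Jᵀ q)
    (hJv : Matrix.toEuclideanLin J v = -b) : ‖v‖ ≤ ‖b‖ / s := by
  have h1 : ‖v‖ ^ 2 = ⟪q, -b⟫ := by
    rw [← hJv, inner_toEuclideanLin_right, ← hv, real_inner_self_eq_norm_sq]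
  have h2 := real_inner_le_norm q (-b)
  rw [norm_neg] at h2
  rw [← hv] at hq
  rw [le_div_iff₀ hs]
  rcases (norm_nonneg v).eq_or_lt with h0 | h0
  · rw [← h0]; simp
  · have h3 := mul_le_mul_of_nonneg_right hq (norm_nonneg b)
    nlinarith

theorem merit_le_of_step {m n : ℕ} {f : EuclideanSpace ℝ (Fin n) → ℝ}
    {gradf : EuclideanSpace ℝ (Fin n) → EuclideanSpace ℝ (Fin n)}
    {c : EuclideanSpace ℝ (Fin n) → EuclideanSpace ℝ (Fin m)}
    {gradc : Fin m → EuclideanSpace ℝ (Fin n) → EuclideanSpace ℝ (Fin n)} {L τ α β : ℝ}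
    {γ : Fin m → ℝ} (hτ : 0 < τ)
    (hf : ∀ z, HasGradientAt f (gradf z) z)
    (hfLip : ∀ z z', ‖gradf z - gradf z'‖ ≤ L * ‖z - z'‖)
    (hc : ∀ i z, HasGradientAt (fun w => c w i) (gradc i z) z)
    (hcLip : ∀ i z z', ‖gradc i z - gradc i z'‖ ≤ γ i * ‖z - z'‖)
    {z u v : EuclideanSpace ℝ (Fin n)}
    (hJu : Matrix.toEuclideanLin (Jmat gradc z) u = 0)
    (hJv : Matrix.toEuclideanLin (Jmat gradc z) v = -c z) (huv : ⟪u, v⟫ = 0) :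
    τ * f (z + α • (β • u + v)) + l1Norm (c (z + α • (β • u + v))) ≤
      τ * f z + (τ * (α * (β * ⟪gradf z, u⟫ + ⟪gradf z, v⟫)) + |1 - α| * l1Norm (c z)
      + (τ * L + ∑ i, γ i) / 2 * (α ^ 2 * (β ^ 2 * ‖u‖ ^ 2 + ‖v‖ ^ 2))) := by
  have h1 := le_quadratic_of_lipschitz_gradient hf hfLip z (α • (β • u + v))
  have h2 := l1Norm_add_le hc hcLip z (α • (β • u + v))
  have hn : ‖α • (β • u + v)‖ ^ 2 = α ^ 2 * (β ^ 2 * ‖u‖ ^ 2 + ‖v‖ ^ 2) := by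
    rw [norm_smul, mul_pow, norm_add_sq_real, inner_smul_left, huv, norm_smul, mul_pow]
    simp
  have hlin : c z + Matrix.toEuclideanLin (Jmat gradc z) (α • (β • u + v)) = (1 - α) • c z := by
    rw [map_smul, map_add, map_smul, hJu, hJv]
    module
  have hl1 : l1Norm ((1 - α) • c z) = |1 - α| * l1Norm (c z) := by
    simp [l1Norm, abs_mul, Finset.mul_sum]
  rw [hlin, hl1, hn] at h2
  rw [hn, inner_smul_right, inner_add_right, inner_smul_right] at h1
  have := mul_le_mul_of_nonneg_left h1 hτ.le
  linarith

/-- Markov's inequality for the minimum of finitely many quantities dominated by nonnegative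
random variables whose sum has bounded mean. -/
theorem ofReal_one_sub_le_measure_exists_le {Ω : Type*} {m0 : MeasurableSpace Ω} {μ : Measure Ω}
    [IsProbabilityMeasure μ] {G X : ℕ → Ω → ℝ} {K : ℕ} (hK : 1 ≤ K) {κ δ q B : ℝ} (hκ : 0 < κ)
    (hδ : 0 < δ) (hq : 0 < q) (hG0 : ∀ k ω, 0 ≤ G k ω) (hGm : ∀ k, StronglyMeasurable (G k))
    (hGint : ∀ k, Integrable (G k) μ) (hGκ : ∑ k ∈ Finset.range K, ∫ ω, G k ω ∂μ ≤ κ)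
    (hX : ∀ k < K, ∀ ω, X k ω ≤ q * G k ω) (hB : q * (κ / δ) ≤ K * B) :
    ENNReal.ofReal (1 - δ) ≤ μ {ω | ∃ k < K, X k ω ≤ B} := by
  set Z : Ω → ℝ := fun ω => ∑ k ∈ Finset.range K, G k ω with hZ
  have hZint : Integrable Z μ := integrable_finsetSum _ fun k _ => hGint k
  have hZm : Measurable Z := Finset.measurable_fun_sum _ fun k _ => (hGm k).measurable
  rw [← integral_finsetSum _ fun k _ => hGint k] at hGκ
  have hmarkov : μ.real {ω | κ / δ ≤ Z ω} ≤ δ := by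
    have h1 := (mul_meas_ge_le_integral_of_nonneg
      (ae_of_all μ fun ω => Finset.sum_nonneg fun k _ => hG0 k ω) hZint (κ / δ)).trans hGκ
    rw [div_mul_eq_mul_div, div_le_iff₀ hδ] at h1
    exact le_of_mul_le_mul_left h1 hκ
  have hprob : 1 - δ ≤ μ.real {ω | κ / δ ≤ Z ω}ᶜ := by
    rw [probReal_compl_eq_one_sub (measurableSet_le measurable_const hZm)]
    linarith
  refine (ENNReal.ofReal_le_ofReal hprob).trans ?_
  rw [ofReal_measureReal]
  refine measure_mono fun ω hω => ?_
  replace hω : Z ω < κ / δ := not_le.1 hω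
  by_contra hbad
  have hbad' : ∀ k < K, B < X k ω := fun k hk => not_le.1 fun h => hbad ⟨k, hk, h⟩
  have hlt := Finset.sum_lt_sum_of_nonempty (Finset.nonempty_range_iff.2 (by omega : K ≠ 0))
    fun k hk => (hbad' k (Finset.mem_range.1 hk)).trans_le (hX k (Finset.mem_range.1 hk) ω)
  rw [Finset.sum_const, Finset.card_range, nsmul_eq_mul, ← Finset.mul_sum] at hlt
  have := mul_lt_mul_of_pos_left hω hq
  linarith

theorem rate_constant_le {K : ℕ} (hK : 1 ≤ K) {ν η δ σ κ₂ κu κ : ℝ} (hν : 0 < ν) (hη : 0 < η)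
    (hδ : 0 < δ) (hσ : 0 < σ) (hκ₂ : 0 < κ₂) (hκu : 0 < κu) (hκ : 0 < κ) :
    (√K / (ν * η) + 2 * κ / (ν * σ)) * (κ₂ / δ) ≤
      K * (κ₂ / (ν * η * δ * √K) + 2 * (1 + 2 * κu) * κ * κ₂ / (ν * σ * δ * K)) := by
  have hK0 : (0 : ℝ) < K := by exact_mod_cast hK
  have hsK : 0 < √(K : ℝ) := Real.sqrt_pos.2 hK0
  have h1 : K * (κ₂ / (ν * η * δ * √K)) = √K / (ν * η) * (κ₂ / δ) := by
    field_simp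
    rw [Real.sq_sqrt hK0.le]
  have h2 : K * (2 * (1 + 2 * κu) * κ * κ₂ / (ν * σ * δ * K))
      = (1 + 2 * κu) * (2 * κ / (ν * σ) * (κ₂ / δ)) := by
    field_simp
  have h3 : 0 ≤ κu * (2 * κ / (ν * σ) * (κ₂ / δ)) := by positivity
  linarith

theorem stationarity_le {τ ζ κH κv κ r ν η β σ S T C : ℝ} (hτ : 0 < τ) (hζ : 0 < ζ) (hκH : 0 < κH)
    (hκv : 0 < κv) (hr : 0 < r) (hν : 0 < ν) (hη : 0 < η) (hσ : 0 < σ) (hT : 0 ≤ T)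
    (hS : S ≤ κH ^ 2 * (T + κv * C)) (hβ : β = η / r) (hκ : κ = ζ * τ * κv) :
    τ * ζ * (κH ^ 2)⁻¹ * S + σ * r / (2 * η) * C ≤
      (r / (ν * η) + 2 * κ / (ν * σ)) * (ν * β * τ * ζ * T + ν * σ / 2 * C) := by
  have h1 : τ * ζ * (κH ^ 2)⁻¹ * S ≤ τ * ζ * (T + κv * C) := by
    refine (mul_le_mul_of_nonneg_left hS (by positivity)).trans_eq ?_
    field_simp
  have h2 : r / (ν * η) * (ν * β * τ * ζ * T + ν * σ / 2 * C)
      = τ * ζ * T + σ * r / (2 * η) * C := by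
    rw [hβ]; field_simp
  have h3 : 2 * κ / (ν * σ) * (ν * β * τ * ζ * T + ν * σ / 2 * C)
      = 2 * κ / σ * β * τ * ζ * T + τ * ζ * (κv * C) := by
    rw [hκ]; field_simp
  have h4 : 0 ≤ 2 * κ / σ * β * τ * ζ * T := by rw [hβ, hκ]; positivity
  linarith

/-- High-probability combined complexity bound for the two-stepsize
stochastic SQP method with pre-specified stepsizes. -/
theorem stmt12 {m n : ℕ} (hm : 1 ≤ m) (hmn : m ≤ n)
    {Ω : Type*} {m0 : MeasurableSpace Ω} (μ : Measure Ω) [IsProbabilityMeasure μ]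
    (ℱ : Filtration ℕ m0)
    -- problem data
    (f : EuclideanSpace ℝ (Fin n) → ℝ)
    (gradf : EuclideanSpace ℝ (Fin n) → EuclideanSpace ℝ (Fin n))
    (c : EuclideanSpace ℝ (Fin n) → EuclideanSpace ℝ (Fin m))
    (gradc : Fin m → EuclideanSpace ℝ (Fin n) → EuclideanSpace ℝ (Fin n))
    (flow L κg κc s ζ κH M ν θ κβ σ : ℝ) (γ : Fin m → ℝ)
    (hL : 0 < L) (hκg : 0 < κg) (hκc : 0 < κc) (hs : 0 < s) (hζ : 0 < ζ)
    (hκH : 0 < κH) (hM : 0 < M) (hθ : 0 < θ) (hκβ : 0 < κβ)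
    (hσ : σ ∈ Set.Ioo (0 : ℝ) 1) (hγ : ∀ i, 0 < γ i)
    (hf : ∀ z, HasGradientAt f (gradf z) z)
    (hflow : ∀ z, flow ≤ f z)
    (hfLip : ∀ z z', ‖gradf z - gradf z'‖ ≤ L * ‖z - z'‖)
    (hgradb : ∀ z, ‖gradf z‖ ≤ κg)
    (hc : ∀ i z, HasGradientAt (fun w => c w i) (gradc i z) z)
    (hcb : ∀ z, l1Norm (c z) ≤ κc)
    (hcLip : ∀ i z z', ‖gradc i z - gradc i z'‖ ≤ γ i * ‖z - z'‖)
    -- algorithm iterates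
    (x0 : EuclideanSpace ℝ (Fin n))
    (x u utrue g v : ℕ → Ω → EuclideanSpace ℝ (Fin n))
    (y ytrue : ℕ → Ω → EuclideanSpace ℝ (Fin m))
    (H : ℕ → Ω → Matrix (Fin n) (Fin n) ℝ)
    (α : ℕ → Ω → ℝ) (β : ℕ → ℝ)
    (hx0 : ∀ ω, x 0 ω = x0)
    (hxmeas : ∀ k, StronglyMeasurable[ℱ k] (x k))
    (hHmeas : ∀ k i j, StronglyMeasurable[ℱ k] (fun ω => H k ω i j))
    (hHnorm : ∀ k ω (z : EuclideanSpace ℝ (Fin n)),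
      ‖Matrix.toEuclideanLin (H k ω) z‖ ≤ κH * ‖z‖)
    (hHpd : ∀ k ω (z : EuclideanSpace ℝ (Fin n)),
      Matrix.toEuclideanLin (Jmat gradc (x k ω)) z = 0 →
      ζ * ‖z‖ ^ 2 ≤ ⟪z, Matrix.toEuclideanLin (H k ω) z⟫)
    (hsv : ∀ k ω (z : EuclideanSpace ℝ (Fin m)),
      s * ‖z‖ ≤ ‖Matrix.toEuclideanLin (Jmat gradc (x k ω))ᵀ z‖)
    (hgmeas : ∀ k, StronglyMeasurable[ℱ (k + 1)] (g k))
    (hgmean : ∀ k, μ[g k | ℱ k] =ᵐ[μ] fun ω => gradf (x k ω))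
    (hgvarint : ∀ k, Integrable (fun ω => ‖g k ω - gradf (x k ω)‖ ^ 2) μ)
    (hgvar : ∀ k, ∀ᵐ ω ∂μ,
      (μ[fun ω' => ‖g k ω' - gradf (x k ω')‖ ^ 2 | ℱ k]) ω ≤ M)
    (humeas : ∀ k, StronglyMeasurable[ℱ (k + 1)] (u k))
    (hymeas : ∀ k, StronglyMeasurable[ℱ (k + 1)] (y k))
    (hvmeas : ∀ k, StronglyMeasurable[ℱ k] (v k))
    (hutmeas : ∀ k, StronglyMeasurable[ℱ k] (utrue k))
    (hytmeas : ∀ k, StronglyMeasurable[ℱ k] (ytrue k))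
    (hJu : ∀ k ω, Matrix.toEuclideanLin (Jmat gradc (x k ω)) (u k ω) = 0)
    (hvrange : ∀ k ω, ∃ z : EuclideanSpace ℝ (Fin m),
      v k ω = Matrix.toEuclideanLin (Jmat gradc (x k ω))ᵀ z)
    (hJp : ∀ k ω, Matrix.toEuclideanLin (Jmat gradc (x k ω)) (u k ω + v k ω)
      = -(c (x k ω)))
    (hsys : ∀ k ω, Matrix.toEuclideanLin (H k ω) (u k ω + v k ω)
      + Matrix.toEuclideanLin (Jmat gradc (x k ω))ᵀ (y k ω) = -(g k ω))
    (hJut : ∀ k ω, Matrix.toEuclideanLin (Jmat gradc (x k ω)) (utrue k ω) = 0)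
    (hsyst : ∀ k ω, Matrix.toEuclideanLin (H k ω) (utrue k ω + v k ω)
      + Matrix.toEuclideanLin (Jmat gradc (x k ω))ᵀ (ytrue k ω) = -(gradf (x k ω)))
    (hβpos : ∀ k, 0 < β k) (hβb : ∀ k, β k ≤ κβ)
    (hαmeas : ∀ k, StronglyMeasurable[ℱ (k + 1)] (α k))
    (hα : ∀ k ω, α k ω ∈ Set.Icc ν (ν + θ * β k))
    (hupdate : ∀ k ω, x (k + 1) ω = x k ω + α k ω • (β k • u k ω + v k ω))
    -- constants
    (κv κu τmin Γ κ₁ : ℝ)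
    (hκv : κv = max (1 / s) (κc / s ^ 2))
    (hκu : κu = ζ⁻¹ * κg + ζ⁻¹ * κH * κv * κc)
    (hΓ : Γ = ∑ i, γ i)
    (hτmin : τmin = (1 - σ) / (κv * (κβ * κH * κu + κg)))
    (hν : ν ∈ Set.Ioc (0 : ℝ) (σ / (2 * (κv * (τmin * L + Γ) + 4))))
    (hκ₁ : κ₁ = (ν + θ * κβ) ^ 2 * (τmin * L + Γ) * (ζ⁻¹ * κH * κu ^ 2 + ζ⁻¹ ^ 2 * M) / 2
      + θ * (θ * κc * (κv * (τmin * L + Γ) + 4) + τmin * κg * ζ⁻¹ * Real.sqrt M))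
    (K : ℕ) (hK : 1 ≤ K) (η : ℝ) (hη : 0 < η)
    (hηβ : η / Real.sqrt K ≤ κβ)
    (hβK : ∀ k < K, β k = η / Real.sqrt K)
    (κ₂ : ℝ) (hκ₂ : κ₂ = τmin * (f x0 - flow) + l1Norm (c x0) + η ^ 2 * κ₁)
    (δ : ℝ) (hδ : δ ∈ Set.Ioo (0 : ℝ) 1) :
    ENNReal.ofReal (1 - δ) ≤
      μ {ω | ∃ k < K,
        τmin * ζ * (κH ^ 2)⁻¹ * ‖gradf (x k ω)
            + Matrix.toEuclideanLin (Jmat gradc (x k ω))ᵀ (ytrue k ω)‖ ^ 2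
          + σ * Real.sqrt K / (2 * η) * l1Norm (c (x k ω))
        ≤ κ₂ / (ν * η * δ * Real.sqrt K)
          + 2 * (1 + 2 * κu) * ζ * τmin * κv * κ₂ / (ν * σ * δ * K)} := by
  have hκv0 : 0 < κv := hκv ▸ lt_max_of_lt_left (by positivity)
  have hκv1 : 1 / s ≤ κv := hκv ▸ le_max_left _ _
  have hκv2 : κc / s ^ 2 ≤ κv := hκv ▸ le_max_right _ _
  have hκu0 : 0 < κu := hκu ▸ by positivity
  obtain ⟨hσ0, hσ1⟩ := hσ
  have hσ1' : 0 < 1 - σ := by linarith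
  have hτ0 : 0 < τmin := hτmin ▸ by positivity
  have hτκ : τmin * (κv * (κβ * κH * κu + κg)) = 1 - σ := by
    rw [hτmin]; field_simp
  have hΓ0 : 0 ≤ Γ := hΓ ▸ Finset.sum_nonneg fun i _ => (hγ i).le
  have hA0 : 0 < τmin * L + Γ := by positivity
  obtain ⟨hν0, hν1⟩ := hν
  have hνσ : ν * (κv * (τmin * L + Γ) + 4) ≤ σ / 2 := by
    rw [le_div_iff₀ (by positivity)] at hν1
    linarith
  have hκ₁0 : 0 < κ₁ := hκ₁ ▸ by positivity
  -- continuity and measurability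
  have hfcont : Continuous f :=
    continuous_iff_continuousAt.2 fun z => (hf z).hasFDerivAt.continuousAt
  have hgradfcont : Continuous gradf := continuous_of_norm_sub_le hfLip
  have hccont : Continuous c := by
    refine (PiLp.continuous_toLp 2 _).comp (continuous_pi fun i => ?_)
    exact continuous_iff_continuousAt.2 fun z => (hc i z).hasFDerivAt.continuousAt
  have hgradcmeas : ∀ k i j, StronglyMeasurable[ℱ k] fun ω => Jmat gradc (x k ω) i j :=
    fun k i j => ((EuclideanSpace.proj (𝕜 := ℝ) j).continuous.comp
      (continuous_of_norm_sub_le (hcLip i))).comp_stronglyMeasurable (hxmeas k)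
  have hgfmeas : ∀ k, StronglyMeasurable[ℱ k] fun ω => gradf (x k ω) := fun k =>
    hgradfcont.comp_stronglyMeasurable (hxmeas k)
  -- bounds on the normal component
  have hJv : ∀ k ω, Matrix.toEuclideanLin (Jmat gradc (x k ω)) (v k ω) = -c (x k ω) := by
    intro k ω
    have := hJp k ω
    rwa [map_add, hJu, zero_add] at this
  have hvc : ∀ k ω, ‖v k ω‖ ≤ l1Norm (c (x k ω)) / s := by
    intro k ω
    obtain ⟨q, hq⟩ := hvrange k ω
    refine (norm_le_of_mem_range_transpose hs (hsv k ω q) hq (hJv k ω)).trans ?_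
    gcongr
    exact norm_le_l1Norm _
  have hl0 : ∀ k ω, 0 ≤ l1Norm (c (x k ω)) := fun k ω => l1Norm_nonneg _
  have hv1 : ∀ k ω, ‖v k ω‖ ≤ κv * l1Norm (c (x k ω)) := by
    intro k ω
    refine (hvc k ω).trans ?_
    rw [div_eq_mul_one_div, mul_comm]
    exact mul_le_mul_of_nonneg_right hκv1 (hl0 k ω)
  have hv2 : ∀ k ω, ‖v k ω‖ ^ 2 ≤ κv * l1Norm (c (x k ω)) := by
    intro k ω
    calc ‖v k ω‖ ^ 2 ≤ (l1Norm (c (x k ω)) / s) ^ 2 := by gcongr; exact hvc k ω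
      _ = l1Norm (c (x k ω)) / s ^ 2 * l1Norm (c (x k ω)) := by ring
      _ ≤ κc / s ^ 2 * l1Norm (c (x k ω)) := by
        gcongr
        · exact hl0 k ω
        · exact hcb _
      _ ≤ _ := mul_le_mul_of_nonneg_right hκv2 (hl0 k ω)
  have horth : ∀ k ω w, Matrix.toEuclideanLin (Jmat gradc (x k ω)) w = 0 → ⟪w, v k ω⟫ = 0 := by
    intro k ω w hw
    obtain ⟨q, hq⟩ := hvrange k ω
    rw [hq, inner_toEuclideanLin_right, Matrix.transpose_transpose, hw, inner_zero_left]
  -- the true tangential component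
  have hut : ∀ k ω, ‖utrue k ω‖ ≤ κu := by
    intro k ω
    have h := norm_le_of_kkt hζ (hHpd k ω _ (hJut k ω)) (hJut k ω)
      (r := -(gradf (x k ω)) - Matrix.toEuclideanLin (H k ω) (v k ω)) (q := ytrue k ω) (by
        rw [← hsyst k ω, map_add]; abel)
    refine h.trans ?_
    have h1 := norm_sub_le (-(gradf (x k ω))) (Matrix.toEuclideanLin (H k ω) (v k ω))
    rw [norm_neg] at h1
    have h2 : κH * ‖v k ω‖ ≤ κH * (κv * κc) := by
      gcongr
      exact (hv1 k ω).trans (by gcongr; exact hcb _)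
    have h3 := mul_le_mul_of_nonneg_left
      (h1.trans (add_le_add (hgradb (x k ω)) ((hHnorm k ω (v k ω)).trans h2))) (inv_pos.2 hζ).le
    rw [hκu]
    linarith
  have hut2 : ∀ k ω, ‖utrue k ω‖ ^ 2 ≤ ζ⁻¹ * κH * κu ^ 2 := by
    intro k ω
    have h1 := hHpd k ω _ (hJut k ω)
    have h2 := (real_inner_le_norm _ _).trans
      (mul_le_mul_of_nonneg_left (hHnorm k ω (utrue k ω)) (norm_nonneg (utrue k ω)))
    have h3 : κH * ‖utrue k ω‖ ^ 2 ≤ κH * κu ^ 2 := by gcongr; exact hut k ω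
    rw [mul_assoc, ← div_eq_inv_mul, le_div_iff₀ hζ]
    linarith
  have hgut : ∀ k ω, ⟪gradf (x k ω), utrue k ω⟫
      ≤ -ζ * ‖utrue k ω‖ ^ 2 + κH * ‖utrue k ω‖ * ‖v k ω‖ := by
    intro k ω
    have h1 := hHpd k ω _ (hJut k ω)
    have h2 := congrArg (fun w => ⟪utrue k ω, w⟫) (hsyst k ω)
    simp only [inner_add_right, map_add, inner_neg_right] at h2
    rw [inner_toEuclideanLin_right (Jmat gradc (x k ω))ᵀ, Matrix.transpose_transpose, hJut,
      inner_zero_left, real_inner_comm (gradf (x k ω))] at h2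
    have h3 := (abs_le.1 (abs_real_inner_le_norm (utrue k ω)
      (Matrix.toEuclideanLin (H k ω) (v k ω)))).1
    have h4 := mul_le_mul_of_nonneg_left (hHnorm k ω (v k ω)) (norm_nonneg (utrue k ω))
    linarith
  -- the gradient noise and the induced noise in the step
  have hemeas : ∀ k, AEStronglyMeasurable (fun ω => g k ω - gradf (x k ω)) μ := fun k =>
    (((hgmeas k).mono (ℱ.le _)).sub ((hgfmeas k).mono (ℱ.le _))).aestronglyMeasurable
  have he : ∀ k, MemLp (fun ω => g k ω - gradf (x k ω)) 2 μ := fun k =>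
    (memLp_two_iff_integrable_sq_norm (hemeas k)).2 (hgvarint k)
  have hgfint : ∀ k, Integrable (fun ω => gradf (x k ω)) μ := fun k =>
    .of_bound ((hgfmeas k).mono (ℱ.le _)).aestronglyMeasurable κg (ae_of_all _ fun ω => hgradb _)
  have hgint : ∀ k, Integrable (g k) μ := fun k => by
    have := ((he k).integrable one_le_two).add (hgfint k)
    refine this.congr (ae_of_all _ fun ω => ?_)
    simp
  have he0 : ∀ k, μ[fun ω => g k ω - gradf (x k ω) | ℱ k] =ᵐ[μ] 0 := by
    intro k
    have h1 := condExp_sub (hgint k) (hgfint k) (ℱ k)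
    rw [condExp_of_stronglyMeasurable (ℱ.le k) (hgfmeas k) (hgfint k)] at h1
    filter_upwards [h1, hgmean k] with ω h2 h3
    refine h2.trans ?_
    simp [h3]
  have he2 : ∀ k, ∫ ω, ‖g k ω - gradf (x k ω)‖ ^ 2 ∂μ ≤ M := by
    intro k
    rw [← integral_condExp (ℱ.le k)]
    simpa using integral_mono_ae integrable_condExp (integrable_const M) (hgvar k)
  have hJW : ∀ k ω, Matrix.toEuclideanLin (Jmat gradc (x k ω)) (u k ω - utrue k ω) = 0 := by
    intro k ω
    rw [map_sub, hJu, hJut, sub_zero]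
  have hWsys : ∀ k ω, Matrix.toEuclideanLin (H k ω) (u k ω - utrue k ω)
      + Matrix.toEuclideanLin (Jmat gradc (x k ω))ᵀ (y k ω - ytrue k ω)
      = -(g k ω - gradf (x k ω)) := by
    intro k ω
    rw [neg_sub', ← hsys k ω, ← hsyst k ω]
    simp only [map_add, map_sub]
    abel
  have hWe : ∀ k ω, ‖u k ω - utrue k ω‖ ≤ ζ⁻¹ * ‖g k ω - gradf (x k ω)‖ := by
    intro k ω
    rw [← norm_neg (g k ω - gradf (x k ω))]
    exact norm_le_of_kkt hζ (hHpd k ω _ (hJW k ω)) (hJW k ω) (hWsys k ω)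
  have hW : ∀ k, MemLp (fun ω => u k ω - utrue k ω) 2 μ := fun k =>
    (he k).of_le_mul (((humeas k).mono (ℱ.le _)).sub
      ((hutmeas k).mono (ℱ.le _))).aestronglyMeasurable (ae_of_all _ (hWe k))
  have hW0 : ∀ k, μ[fun ω => u k ω - utrue k ω | ℱ k] =ᵐ[μ] 0 := fun k =>
    condExp_eq_zero_of_kkt (ℱ.le k) hζ (hHmeas k) (hgradcmeas k) (hHnorm k) (hHpd k) (hW k) (he k)
      (he0 k) (hJW k) (hWsys k)
  have hD₁ : ∀ k, ∫ ω, ‖u k ω - utrue k ω‖ ∂μ ≤ ζ⁻¹ * √M := by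
    intro k
    have h1 := integral_mono ((hW k).integrable one_le_two).norm
      (((he k).integrable one_le_two).norm.const_mul ζ⁻¹) (hWe k)
    rw [integral_const_mul] at h1
    exact h1.trans (by gcongr; exact integral_norm_le_sqrt hM (he k) (he2 k))
  have hD₂ : ∀ k, ∫ ω, ‖u k ω - utrue k ω‖ ^ 2 ∂μ ≤ ζ⁻¹ ^ 2 * M := by
    intro k
    have h1 := integral_mono ((hW k).integrable_norm_pow two_ne_zero)
      ((hgvarint k).const_mul (ζ⁻¹ ^ 2)) fun ω => by
        have := pow_le_pow_left₀ (norm_nonneg _) (hWe k ω) 2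
        rwa [mul_pow] at this
    rw [integral_const_mul] at h1
    exact h1.trans (by gcongr; exact he2 k)
  -- the merit function and the model decrease
  set φ : ℕ → Ω → ℝ := fun k ω => τmin * f (x k ω) + l1Norm (c (x k ω)) with hφ
  set G : ℕ → Ω → ℝ := fun k ω =>
    ν * β k * τmin * ζ * ‖utrue k ω‖ ^ 2 + ν * σ / 2 * l1Norm (c (x k ω)) with hG
  have hG0 : ∀ k ω, 0 ≤ G k ω := by
    intro k ω
    have := hl0 k ω
    have := hβpos k
    positivity
  have hGm : ∀ k, StronglyMeasurable (G k) := fun k =>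
    ((((hutmeas k).mono (ℱ.le k)).norm.pow 2).const_mul _).add
      (((continuous_l1Norm.comp hccont).comp_stronglyMeasurable
        ((hxmeas k).mono (ℱ.le k))).const_mul _)
  have hGint : ∀ k, Integrable (G k) μ := fun k => by
    refine .of_bound (hGm k).aestronglyMeasurable
      (ν * β k * τmin * ζ * κu ^ 2 + ν * σ / 2 * κc) (ae_of_all _ fun ω => ?_)
    rw [Real.norm_of_nonneg (hG0 k ω)]
    have := hβpos k
    simp only [hG]
    gcongr
    · exact hut k ω
    · exact hcb _
  have hφm : ∀ k, StronglyMeasurable (φ k) := fun k =>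
    ((hfcont.const_mul τmin).add (continuous_l1Norm.comp hccont)).comp_stronglyMeasurable
      ((hxmeas k).mono (ℱ.le k))
  have hφlo : ∀ k ω, τmin * flow ≤ φ k ω := fun k ω => by
    have := mul_le_mul_of_nonneg_left (hflow (x k ω)) hτ0.le
    have := hl0 k ω
    simp only [hφ]
    linarith
  have hdec : ∀ k ω, φ (k + 1) ω ≤ φ k ω - G k ω
      + ν * β k * τmin * ⟪gradf (x k ω), u k ω - utrue k ω⟫
      + θ * β k ^ 2 * τmin * κg * ‖u k ω - utrue k ω‖
      + θ ^ 2 * β k ^ 2 * κc * (κv * (τmin * L + Γ) + 4)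
      + (ν + θ * κβ) ^ 2 * β k ^ 2 * (τmin * L + Γ) / 2
        * ‖utrue k ω + (u k ω - utrue k ω)‖ ^ 2 := by
    intro k ω
    have h1 := merit_le_of_step (α := α k ω) (β := β k) hτ0 hf hfLip hc hcLip (hJu k ω) (hJv k ω)
      (horth k ω _ (hJu k ω))
    rw [← hupdate, ← hΓ] at h1
    have hcs : ∀ w, |⟪gradf (x k ω), w⟫| ≤ κg * ‖w‖ := fun w =>
      (abs_real_inner_le_norm _ _).trans (by gcongr; exact hgradb _)
    have h2 := merit_model_decrease (nu := ‖u k ω‖) hν0 hθ (hβpos k) (hβb k) (hα k ω) hτ0 hA0.le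
      (hl0 k ω) (hcb _) hκv0 hκH hκu0 hκg hζ hσ0 hτκ hνσ (norm_nonneg _) (hut k ω) (norm_nonneg _)
      (hv1 k ω) (hv2 k ω)
      (by rw [← inner_add_right, add_sub_cancel] :
        ⟪gradf (x k ω), u k ω⟫ = ⟪gradf (x k ω), utrue k ω⟫
          + ⟪gradf (x k ω), u k ω - utrue k ω⟫)
      (hgut k ω) ((le_abs_self _).trans (hcs _)) (hcs _)
    rw [add_sub_cancel]
    simp only [hφ, hG]
    linarith
  have hstep : ∀ k, Integrable (φ k) μ → Integrable (φ (k + 1)) μ ∧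
      ∫ ω, φ (k + 1) ω ∂μ ≤ ∫ ω, φ k ω ∂μ - ∫ ω, G k ω ∂μ + β k ^ 2 * κ₁ := by
    intro k hk
    have hβ0 := hβpos k
    obtain ⟨h1, h2⟩ := integral_merit_step (ℱ.le k) (by positivity) (by positivity) (hgfmeas k)
      (fun ω => hgradb _) (hutmeas k) (hut k) (hW k) (hW0 k) (hD₁ k) (hD₂ k) hk (hGint k)
      (hφm (k + 1)).aestronglyMeasurable (hφlo (k + 1)) (hdec k)
    refine ⟨h1, h2.trans ?_⟩
    have h3 : ∫ ω, ‖utrue k ω‖ ^ 2 ∂μ ≤ ζ⁻¹ * κH * κu ^ 2 := by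
      have h4 : MemLp (utrue k) 2 μ :=
        .of_bound ((hutmeas k).mono (ℱ.le k)).aestronglyMeasurable κu (ae_of_all _ (hut k))
      simpa using integral_mono (h4.integrable_norm_pow two_ne_zero)
        (integrable_const (ζ⁻¹ * κH * κu ^ 2)) (hut2 k)
    have h5 := mul_le_mul_of_nonneg_left h3
      (by positivity : 0 ≤ (ν + θ * κβ) ^ 2 * β k ^ 2 * (τmin * L + Γ) / 2)
    rw [hκ₁]
    linarith
  have hsum : ∀ N, Integrable (φ N) μ ∧ ∫ ω, φ N ω ∂μ + ∑ k ∈ Finset.range N, ∫ ω, G k ω ∂μ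
      ≤ τmin * f x0 + l1Norm (c x0) + (∑ k ∈ Finset.range N, β k ^ 2) * κ₁ := by
    intro N
    induction N with
    | zero => simp [hφ, hx0]
    | succ N ih =>
      obtain ⟨h1, h2⟩ := hstep N ih.1
      refine ⟨h1, ?_⟩
      rw [Finset.sum_range_succ, Finset.sum_range_succ]
      linarith [ih.2]
  have hK0 : (0 : ℝ) < K := by exact_mod_cast hK
  have hsK : 0 < √(K : ℝ) := Real.sqrt_pos.2 hK0
  have hGκ : ∑ k ∈ Finset.range K, ∫ ω, G k ω ∂μ ≤ κ₂ := by
    obtain ⟨h1, h2⟩ := hsum K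
    have h3 : ∑ k ∈ Finset.range K, β k ^ 2 = η ^ 2 := by
      rw [Finset.sum_congr rfl fun k hk => by rw [hβK k (Finset.mem_range.1 hk)]]
      rw [Finset.sum_const, Finset.card_range, nsmul_eq_mul, div_pow, Real.sq_sqrt hK0.le]
      field_simp
    have h4 := integral_mono (integrable_const (τmin * flow)) h1 (hφlo K)
    rw [integral_const, probReal_univ, one_smul] at h4
    rw [h3] at h2
    rw [hκ₂]
    linarith
  have hκ₂0 : 0 < κ₂ := by
    have h1 := mul_nonneg hτ0.le (sub_nonneg.2 (hflow x0))
    have h2 := l1Norm_nonneg (c x0)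
    rw [hκ₂]
    positivity
  have hstat : ∀ k ω, ‖gradf (x k ω)
      + Matrix.toEuclideanLin (Jmat gradc (x k ω))ᵀ (ytrue k ω)‖ ^ 2
      ≤ κH ^ 2 * (‖utrue k ω‖ ^ 2 + κv * l1Norm (c (x k ω))) := by
    intro k ω
    have h1 : gradf (x k ω) + Matrix.toEuclideanLin (Jmat gradc (x k ω))ᵀ (ytrue k ω)
        = -Matrix.toEuclideanLin (H k ω) (utrue k ω + v k ω) := by
      rw [← neg_neg (gradf (x k ω)), ← hsyst k ω]; abel
    have h2 := pow_le_pow_left₀ (norm_nonneg _) (hHnorm k ω (utrue k ω + v k ω)) 2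
    rw [mul_pow, norm_add_sq_real, horth k ω _ (hJut k ω), mul_zero, add_zero] at h2
    rw [h1, norm_neg]
    exact h2.trans (by gcongr; exact hv2 k ω)
  have hκ0 : 0 < ζ * τmin * κv := by positivity
  refine ofReal_one_sub_le_measure_exists_le hK hκ₂0 hδ.1
    (q := √K / (ν * η) + 2 * (ζ * τmin * κv) / (ν * σ)) (by positivity) hG0 hGm hGint hGκ
    (fun k hk ω => stationarity_le hτ0 hζ hκH hκv0 hsK hν0 hη hσ0 (sq_nonneg _) (hstat k ω)
      (hβK k hk) rfl) ?_
  rw [mul_assoc _ ζ τmin, mul_assoc _ (ζ * τmin) κv]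
  exact rate_constant_le hK hν0 hη hδ.1 hσ0 hκ₂0 hκu0 hκ0
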